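/- Let C be a binary linear code of length n over 𝔽₂ with {0} ⊊ C ⊊ 𝔽₂^n and with the all-ones vector 1_n ∈ C. Let d be the minimum distance of C and d^⊥ the minimum distance of C^⊥. Suppose there is a natural number t with 1 ≤ t < d such that the number of values u with 0 < u ≤ n - t for which C contains a codeword of weight u equals d^⊥ - t, and suppose d^⊥ - t = 5. Then (d^⊥, t) = (6, 1), (8, 3), or (10, 5). -/

import Mathlib

/-- The (Hamming) weight of a vector in `𝔽₂ⁿ`. -/
def wt {n : ℕ} (x : Fin n → ZMod 2) : ℕ :=
  (Finset.univ.filter fun i => x i ≠ 0).card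

/-- The dual code of a binary code `C`, as a set of vectors. -/
def dualSet {n : ℕ} (C : Submodule (ZMod 2) (Fin n → ZMod 2)) : Set (Fin n → ZMod 2) :=
  {y | ∀ x ∈ C, ∑ i, x i * y i = 0}

/-- The minimum distance of a (nonzero) code: the least weight of a nonzero codeword
(`0` if there is none, by the convention `sInf ∅ = 0`). -/
noncomputable def minDist {n : ℕ} (D : Set (Fin n → ZMod 2)) : ℕ :=
  sInf {u | ∃ x ∈ D, x ≠ 0 ∧ wt x = u}

/-- The nontrivial additive character of `ZMod 2`, with integer values. -/
def chi (a : ZMod 2) : ℤ := if a = 0 then 1 else -1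

lemma chi_zero : chi 0 = 1 := by decide

lemma chi_one : chi 1 = -1 := by decide

lemma chi_add (a b : ZMod 2) : chi (a + b) = chi a * chi b := by
  revert a b; decide

lemma chi_sum {ι : Type*} (s : Finset ι) (f : ι → ZMod 2) :
    chi (∑ i ∈ s, f i) = ∏ i ∈ s, chi (f i) := by
  classical
  induction s using Finset.induction_on with
  | empty => simp [chi_zero]
  | insert a s ha ih => rw [Finset.sum_insert ha, Finset.prod_insert ha, chi_add, ih]

/-- The sum of the signs of a vector. -/
def xval {n : ℕ} (x : Fin n → ZMod 2) : ℤ := ∑ i, chi (x i)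

lemma xval_eq {n : ℕ} (x : Fin n → ZMod 2) : xval x = (n : ℤ) - 2 * (wt x : ℤ) := by
  have h : ∀ i, chi (x i) = 1 - 2 * (if x i ≠ 0 then 1 else 0) := by
    intro i
    unfold chi
    split_ifs <;> simp_all
  unfold xval wt
  rw [Finset.sum_congr rfl (fun i _ => h i), Finset.sum_sub_distrib, ← Finset.mul_sum,
    Finset.card_filter]
  simp

/-- The weighted dot product. -/
def dotp {n : ℕ} (x y : Fin n → ZMod 2) : ZMod 2 := ∑ i, x i * y i

lemma dotp_add {n : ℕ} (x y z : Fin n → ZMod 2) : dotp (x + y) z = dotp x z + dotp y z := by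
  simp [dotp, add_mul, Finset.sum_add_distrib]

open Classical in
lemma char_sum_zero {n : ℕ} (C : Submodule (ZMod 2) (Fin n → ZMod 2)) (v : Fin n → ZMod 2)
    (hv : v ∉ dualSet C) : ∑ c ∈ Finset.univ.filter (fun c => c ∈ C), chi (dotp c v) = 0 := by
  have : ∃ c0 ∈ C, dotp c0 v ≠ 0 := by
    by_contra hcon
    push Not at hcon
    exact hv (fun x hx => hcon x hx)
  obtain ⟨c0, hc0, hne⟩ := this
  have h1 : dotp c0 v = 1 := by
    generalize dotp c0 v = a at hne
    revert a; decide
  have key : ∑ c ∈ Finset.univ.filter (fun c => c ∈ C), chi (dotp c v)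
      = ∑ c ∈ Finset.univ.filter (fun c => c ∈ C), - chi (dotp c v) := by
    refine Finset.sum_nbij' (fun c => c + c0) (fun c => c - c0) ?_ ?_ ?_ ?_ ?_
    · intro c hc
      simp only [Finset.mem_filter, Finset.mem_univ, true_and] at hc ⊢
      exact C.add_mem hc hc0
    · intro c hc
      simp only [Finset.mem_filter, Finset.mem_univ, true_and] at hc ⊢
      exact C.sub_mem hc hc0
    · intro c _; simp
    · intro c _; simp
    · intro c _
      rw [dotp_add, chi_add, h1, chi_one]; ring
  rw [Finset.sum_neg_distrib] at key
  linarith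

lemma dotp_single {n : ℕ} (c : Fin n → ZMod 2) (j : ℕ) (f : Fin j → Fin n) :
    dotp c (∑ k, Pi.single (f k) 1) = ∑ k, c (f k) := by
  unfold dotp
  simp only [Finset.sum_apply, Finset.mul_sum]
  rw [Finset.sum_comm]
  refine Finset.sum_congr rfl fun k _ => ?_
  simp [Pi.single_apply]

lemma wt_single_sum {n : ℕ} (j : ℕ) (f : Fin j → Fin n) :
    wt (∑ k, Pi.single (f k) (1 : ZMod 2)) ≤ j := by
  unfold wt
  calc _ ≤ (Finset.univ.image f).card := by
        apply Finset.card_le_card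
        intro i hi
        simp only [Finset.mem_filter, Finset.mem_univ, true_and, Finset.sum_apply] at hi
        obtain ⟨k, _, hk⟩ := Finset.exists_ne_zero_of_sum_ne_zero hi
        simp only [Pi.single_apply] at hk
        simp only [Finset.mem_image, Finset.mem_univ, true_and]
        refine ⟨k, ?_⟩
        by_contra hne
        exact hk (if_neg (fun h => hne h.symm))
    _ ≤ _ := by
        refine Finset.card_image_le.trans ?_
        simp

lemma xval_pow {n : ℕ} (c : Fin n → ZMod 2) (j : ℕ) :
    xval c ^ j = ∑ f : Fin j → Fin n, chi (dotp c (∑ k, Pi.single (f k) 1)) := by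
  unfold xval
  rw [Fintype.sum_pow]
  refine Finset.sum_congr rfl fun f _ => ?_
  rw [dotp_single, chi_sum]

lemma dual_top {n : ℕ} (v : Fin n → ZMod 2)
    (hv : v ∈ dualSet (⊤ : Submodule (ZMod 2) (Fin n → ZMod 2))) : v = 0 := by
  funext i
  have := hv (Pi.single i 1) trivial
  simpa [Pi.single_apply] using this

open Classical in
lemma moment_eq {n : ℕ} (C : Submodule (ZMod 2) (Fin n → ZMod 2)) (j : ℕ)
    (hj : ∀ y ∈ dualSet C, y ≠ 0 → j < wt y) :
    (2 : ℤ) ^ n * ∑ c ∈ Finset.univ.filter (fun c => c ∈ C), xval c ^ j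
      = ((Finset.univ.filter (fun c => c ∈ C)).card : ℤ) * ∑ x : Fin n → ZMod 2, xval x ^ j := by
  simp only [xval_pow]
  rw [Finset.sum_comm, Finset.sum_comm (s := (Finset.univ : Finset (Fin n → ZMod 2))),
    Finset.mul_sum, Finset.mul_sum]
  refine Finset.sum_congr rfl fun f _ => ?_
  by_cases hv : (∑ k, Pi.single (f k) (1 : ZMod 2)) = (0 : Fin n → ZMod 2)
  · rw [hv]
    simp [dotp, chi_zero, mul_comm]
  · have hC : (∑ k, Pi.single (f k) (1 : ZMod 2)) ∉ dualSet C := by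
      intro hmem
      have := hj _ hmem hv
      have := wt_single_sum j f
      omega
    have hT : (∑ k, Pi.single (f k) (1 : ZMod 2)) ∉
        dualSet (⊤ : Submodule (ZMod 2) (Fin n → ZMod 2)) := fun h => hv (dual_top _ h)
    have e1 := char_sum_zero C _ hC
    have e2 := char_sum_zero ⊤ _ hT
    simp only [Submodule.mem_top, Finset.filter_true] at e2
    rw [e1, e2]; simp

lemma full_step (n j : ℕ) : ∑ x : Fin (n + 1) → ZMod 2, xval x ^ j
    = ∑ x : Fin n → ZMod 2, ((xval x + 1) ^ j + (xval x - 1) ^ j) := by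
  rw [← (Fin.consEquiv (fun _ => ZMod 2)).sum_comp, Fintype.sum_prod_type, Finset.sum_comm]
  refine Finset.sum_congr rfl fun x _ => ?_
  have h : ∀ a : ZMod 2, xval (Fin.cons a x : Fin (n + 1) → ZMod 2) = chi a + xval x := by
    intro a
    simp [xval, Fin.sum_univ_succ]
  have h2 : ∀ g : ZMod 2 → ℤ, ∑ a, g a = g 0 + g 1 := fun g => Fin.sum_univ_two g
  rw [h2]
  simp only [Fin.consEquiv, Equiv.coe_fn_mk]
  rw [h, h, chi_zero, chi_one]
  ring

lemma full_moments (n : ℕ) :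
    (∑ x : Fin n → ZMod 2, xval x ^ 2 = 2 ^ n * (n : ℤ)) ∧
    (∑ x : Fin n → ZMod 2, xval x ^ 4 = 2 ^ n * (3 * (n : ℤ) ^ 2 - 2 * n)) ∧
    (∑ x : Fin n → ZMod 2, xval x ^ 6 = 2 ^ n * (15 * (n : ℤ) ^ 3 - 30 * n ^ 2 + 16 * n)) ∧
    (∑ x : Fin n → ZMod 2, xval x ^ 8
      = 2 ^ n * (105 * (n : ℤ) ^ 4 - 420 * n ^ 3 + 588 * n ^ 2 - 272 * n)) ∧
    (∑ x : Fin n → ZMod 2, xval x ^ 10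
      = 2 ^ n * (945 * (n : ℤ) ^ 5 - 6300 * n ^ 4 + 16380 * n ^ 3 - 18960 * n ^ 2 + 7936 * n)) := by
  induction n with
  | zero => simp [xval]
  | succ n ih =>
    obtain ⟨i2, i4, i6, i8, i10⟩ := ih
    have i0 : ∑ x : Fin n → ZMod 2, (1 : ℤ) = 2 ^ n := by simp
    have p2 : ∀ a : ℤ, (a + 1) ^ 2 + (a - 1) ^ 2 = 2 * a ^ 2 + 2 * 1 := by intro a; ring
    have p4 : ∀ a : ℤ, (a + 1) ^ 4 + (a - 1) ^ 4 = 2 * a ^ 4 + 12 * a ^ 2 + 2 * 1 := by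
      intro a; ring
    have p6 : ∀ a : ℤ, (a + 1) ^ 6 + (a - 1) ^ 6
        = 2 * a ^ 6 + 30 * a ^ 4 + 30 * a ^ 2 + 2 * 1 := by
      intro a; ring
    have p8 : ∀ a : ℤ, (a + 1) ^ 8 + (a - 1) ^ 8
        = 2 * a ^ 8 + 56 * a ^ 6 + 140 * a ^ 4 + 56 * a ^ 2 + 2 * 1 := by
      intro a; ring
    have p10 : ∀ a : ℤ, (a + 1) ^ 10 + (a - 1) ^ 10
        = 2 * a ^ 10 + 90 * a ^ 8 + 420 * a ^ 6 + 420 * a ^ 4 + 90 * a ^ 2 + 2 * 1 := by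
      intro a; ring
    refine ⟨?_, ?_, ?_, ?_, ?_⟩
    · simp only [full_step, p2, Finset.sum_add_distrib, ← Finset.mul_sum, i0, i2]
      push_cast; ring
    · simp only [full_step, p4, Finset.sum_add_distrib, ← Finset.mul_sum, i0, i2, i4]
      push_cast; ring
    · simp only [full_step, p6, Finset.sum_add_distrib, ← Finset.mul_sum, i0, i2, i4, i6]
      push_cast; ring
    · simp only [full_step, p8, Finset.sum_add_distrib, ← Finset.mul_sum, i0, i2, i4, i6, i8]
      push_cast; ring
    · simp only [full_step, p10, Finset.sum_add_distrib, ← Finset.mul_sum, i0, i2, i4, i6, i8,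
        i10]
      push_cast; ring

lemma odd_dvd (q K : ℕ) (hq : q % 2 = 1) (h : q ∣ 15 * 2 ^ K) : q ≤ 15 := by
  have hc : Nat.Coprime q (2 ^ K) := by
    apply Nat.Coprime.pow_right
    exact (Nat.coprime_two_right).2 (Nat.odd_iff.2 hq)
  exact Nat.le_of_dvd (by norm_num) (hc.dvd_of_dvd_mul_right h)

lemma numth (n K : ℕ) (hn : 20 ≤ n) (f : ℕ)
    (hf : f + 10 * n ^ 3 + 110 * n = n ^ 4 + 55 * n ^ 2 + 184)
    (h : n * f = 15 * 2 ^ K) : False := by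
  have hdn : n ∣ 15 * 2 ^ K := ⟨f, h.symm⟩
  have hdf : f ∣ 15 * 2 ^ K := ⟨n, by rw [← h, mul_comm]⟩
  have hbig : 120 < f := by nlinarith [mul_self_nonneg (n * n), Nat.zero_le (n ^ 2), Nat.mul_le_mul_right (n^3) hn, Nat.mul_le_mul_right n hn]
  by_cases h16 : 16 ∣ n
  · obtain ⟨m, rfl⟩ := h16
    have h8 : f % 16 = 8 := by
      ring_nf at hf
      omega
    have : f / 8 ∣ 15 * 2 ^ K := (Nat.div_dvd_of_dvd (by omega)).trans hdf
    have := odd_dvd _ _ (by omega) this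
    omega
  · obtain ⟨a, m, hm, rfl⟩ := Nat.exists_eq_two_pow_mul_odd (n := n) (by omega)
    have ha : a < 4 := by
      by_contra hcon
      exact h16 (Dvd.dvd.mul_right (pow_dvd_pow 2 (show 4 ≤ a by omega)) m)
    have hmle := odd_dvd m K (Nat.odd_iff.1 hm) ((Dvd.intro_left _ rfl).trans hdn)
    have hm2 := Nat.odd_iff.1 hm
    have hcop : ∀ q, q % 2 = 1 → 15 < q → ¬ q ∣ f := by
      intro q h1 h2 h3
      have := odd_dvd q K h1 (h3.trans hdf)
      omega
    interval_cases a <;> interval_cases m <;> first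
      | omega
      | exact hcop (f / 8) (by omega) (by omega) (Nat.div_dvd_of_dvd (by omega))
      | exact hcop (f / 16) (by omega) (by omega) (Nat.div_dvd_of_dvd (by omega))
      | exact hcop (f / 32) (by omega) (by omega) (Nat.div_dvd_of_dvd (by omega))
      | exact hcop (f / 64) (by omega) (by omega) (Nat.div_dvd_of_dvd (by omega))

lemma algebra_core (n c e1 e2 P2 P4 P6 P8 P10 : ℤ) (hn : 20 ≤ n) (hc : 0 < c)
    (h2 : P2 = c * n) (h4 : P4 = c * (3 * n ^ 2 - 2 * n))
    (h6 : P6 = c * (15 * n ^ 3 - 30 * n ^ 2 + 16 * n))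
    (h8 : P8 = c * (105 * n ^ 4 - 420 * n ^ 3 + 588 * n ^ 2 - 272 * n))
    (h10 : P10 = c * (945 * n ^ 5 - 6300 * n ^ 4 + 16380 * n ^ 3 - 18960 * n ^ 2 + 7936 * n))
    (q1 : P8 - (e1 + n ^ 2) * P6 + (e2 + e1 * n ^ 2) * P4 - e2 * n ^ 2 * P2 = 0)
    (q2 : P10 - (e1 + n ^ 2) * P8 + (e2 + e1 * n ^ 2) * P6 - e2 * n ^ 2 * P4 = 0)
    (q3 : P6 - e1 * P4 + e2 * P2 = 2 * n ^ 2 * (n ^ 4 - e1 * n ^ 2 + e2)) :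
    n * (n ^ 4 - 10 * n ^ 3 + 55 * n ^ 2 - 110 * n + 184) = 60 * c := by
  subst h2 h4 h6 h8 h10
  have hne : c * (n * (n - 1) * (n - 2)) ≠ 0 := by
    have : n ≠ 0 := by omega
    have : n - 1 ≠ 0 := by omega
    have : n - 2 ≠ 0 := by omega
    positivity
  set a := e1 - (10 * n - 40) with ha
  set b := e2 - (15 * n ^ 2 - 110 * n + 184) with hb
  have he1 : e1 = a + (10 * n - 40) := by rw [ha]; ring
  have he2 : e2 = b + (15 * n ^ 2 - 110 * n + 184) := by rw [hb]; ring
  clear_value a b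
  subst he1 he2
  have r1 : c * (n * (n - 1) * (n - 2)) * (b - a * (3 * n - 8)) = 0 := by
    linear_combination -q1
  have r2 : c * (n * (n - 1) * (n - 2)) * (b * (3 * n - 8) - a * (15 * n ^ 2 - 90 * n + 136)) = 0 := by
    linear_combination -q2
  have s1 := (mul_eq_zero.1 r1).resolve_left hne
  have s2 := (mul_eq_zero.1 r2).resolve_left hne
  have s3 : a * ((n - 3) * (n - 4)) = 0 := by
    have : 6 * (a * ((n - 3) * (n - 4))) = 0 := by
      linear_combination (3 * n - 8) * s1 - s2
    omega
  have hne2 : (n - 3) * (n - 4) ≠ 0 := by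
    have : n - 3 ≠ 0 := by omega
    have : n - 4 ≠ 0 := by omega
    positivity
  have a0 := (mul_eq_zero.1 s3).resolve_right hne2
  subst a0
  have b0 : b = 0 := by linarith
  subst b0
  have hn0 : 2 * n ≠ 0 := by omega
  apply mul_left_cancel₀ hn0
  linear_combination -q3

lemma weights_shape (n : ℕ) (U : Finset ℕ) (hcard : U.card = 5) (h8 : ∀ u ∈ U, 8 ≤ u)
    (hlt : ∀ u ∈ U, u < n) (hs : ∀ u ∈ U, n - u ∈ U) :
    20 ≤ n ∧ ∃ w1 w2 : ℕ, ∀ u ∈ U, u = w1 ∨ u = w2 ∨ 2 * u = n ∨ u + w1 = n ∨ u + w2 = n := by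
  classical
  set L := U.filter (fun u => 2 * u < n) with hL
  set M := U.filter (fun u => 2 * u = n) with hM
  set R := U.filter (fun u => n < 2 * u) with hR
  have hLR : L.card = R.card := by
    refine Finset.card_nbij' (fun u => n - u) (fun u => n - u) ?_ ?_ ?_ ?_
    · intro u hu
      simp only [hL, hR, Finset.coe_filter, Set.mem_setOf_eq] at hu ⊢
      exact ⟨hs u hu.1, by omega⟩
    · intro u hu
      simp only [hL, hR, Finset.coe_filter, Set.mem_setOf_eq] at hu ⊢
      have := hlt u hu.1
      exact ⟨hs u hu.1, by omega⟩
    · intro u hu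
      simp only [hL, Finset.coe_filter, Set.mem_setOf_eq] at hu
      have := hlt u hu.1
      simp only; omega
    · intro u hu
      simp only [hR, Finset.coe_filter, Set.mem_setOf_eq] at hu
      have := hlt u hu.1
      simp only; omega
  have hM1 : M.card ≤ 1 := by
    rw [Finset.card_le_one]
    intro a ha b hb
    simp only [hM, Finset.mem_filter] at ha hb
    omega
  have hsum : U.card = L.card + M.card + R.card := by
    rw [hL, hM, hR, Finset.card_filter, Finset.card_filter, Finset.card_filter,
      ← Finset.sum_add_distrib, ← Finset.sum_add_distrib, Finset.card_eq_sum_ones]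
    refine Finset.sum_congr rfl fun u _ => ?_
    split_ifs <;> omega
  have hL2 : L.card = 2 := by omega
  have hM2 : M.card = 1 := by omega
  obtain ⟨w1, w2, hne, hw⟩ := Finset.card_eq_two.1 hL2
  obtain ⟨m, hm⟩ := Finset.card_eq_one.1 hM2
  have m1 : w1 ∈ L := by rw [hw]; simp
  have m2 : w2 ∈ L := by rw [hw]; simp
  have mm : m ∈ M := by rw [hm]; simp
  have hLm : ∀ u ∈ U, 2 * u < n → u = w1 ∨ u = w2 := by
    intro u hu h
    have : u ∈ L := by rw [hL]; simp [hu, h]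
    rw [hw] at this
    simpa using this
  simp only [hL, hM, Finset.mem_filter] at m1 m2 mm
  have := h8 _ m1.1
  have := h8 _ m2.1
  refine ⟨by omega, w1, w2, fun u hu => ?_⟩
  have hun := hlt u hu
  rcases lt_trichotomy (2 * u) n with h | h | h
  · rcases hLm u hu h with h | h <;> omega
  · omega
  · rcases hLm (n - u) (hs u hu) (by omega) with h | h <;> omega

lemma wt_eq_zero {n : ℕ} (x : Fin n → ZMod 2) (h : wt x = 0) : x = 0 := by
  unfold wt at h
  rw [Finset.card_eq_zero, Finset.filter_eq_empty_iff] at h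
  funext i
  simpa using h (Finset.mem_univ i)

lemma wt_compl {n : ℕ} (x : Fin n → ZMod 2) : (wt ((fun _ => 1) + x) : ℤ) = n - wt x := by
  have h1 := xval_eq x
  have h2 := xval_eq ((fun _ => 1) + x)
  have h3 : xval ((fun _ => 1) + x) = - xval x := by
    unfold xval
    rw [← Finset.sum_neg_distrib]
    refine Finset.sum_congr rfl fun i _ => ?_
    rw [Pi.add_apply, chi_add, chi_one]; ring
  linarith

lemma wt_cast {n : ℕ} (y : Fin n → ZMod 2) : ((wt y : ℕ) : ZMod 2) = ∑ i, y i := by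
  unfold wt
  rw [Finset.card_filter]
  push_cast
  refine Finset.sum_congr rfl fun i _ => ?_
  generalize y i = a
  revert a; decide

open Classical in
lemma core {n : ℕ} (C : Submodule (ZMod 2) (Fin n → ZMod 2)) (hn : 20 ≤ n)
    (h1 : (fun _ => (1 : ZMod 2)) ∈ C) (w1 w2 : ℕ)
    (hw : ∀ c ∈ C, wt c = 0 ∨ wt c = n ∨ wt c = w1 ∨ wt c = w2 ∨ 2 * wt c = n ∨
      wt c + w1 = n ∨ wt c + w2 = n)
    (hd : ∀ y ∈ dualSet C, y ≠ 0 → 10 < wt y) : False := by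
  set S := Finset.univ.filter (fun c => c ∈ C) with hS
  set A : ℤ := ((n : ℤ) - 2 * w1) ^ 2 with hA
  set B : ℤ := ((n : ℤ) - 2 * w2) ^ 2 with hB
  have hmemS : ∀ c, c ∈ S ↔ c ∈ C := by intro c; simp [hS]
  have hcard : S.card = 2 ^ Module.finrank (ZMod 2) C := by
    have := Module.card_eq_pow_finrank (K := ZMod 2) (V := C)
    rw [ZMod.card] at this
    rw [← this, hS, Fintype.card_subtype]
  have hpos : (0 : ℤ) < S.card := by rw [hcard]; positivity
  obtain ⟨f2, f4, f6, f8, f10⟩ := full_moments n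
  have mom : ∀ j, j ≤ 10 → ∀ m : ℤ, ∑ x : Fin n → ZMod 2, xval x ^ j = 2 ^ n * m →
      ∑ c ∈ S, xval c ^ j = S.card * m := by
    intro j hj m hm
    have := moment_eq C j (fun y hy hy0 => lt_of_le_of_lt hj (hd y hy hy0))
    rw [hm] at this
    have h2 : (2 : ℤ) ^ n ≠ 0 := by positivity
    apply mul_left_cancel₀ h2
    rw [hS, this]; ring
  have g2 := mom 2 (by norm_num) _ f2
  have g4 := mom 4 (by norm_num) _ f4
  have g6 := mom 6 (by norm_num) _ f6
  have g8 := mom 8 (by norm_num) _ f8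
  have g10 := mom 10 (by norm_num) _ f10
  -- pointwise vanishing
  have van0 : ∀ c ∈ C, wt c = 0 ∨ wt c = n ∨
      xval c ^ 2 * (xval c ^ 2 - A) * (xval c ^ 2 - B) = 0 := by
    intro c hc
    have hx := xval_eq c
    rcases hw c hc with h | h | h | h | h | h | h
    · exact Or.inl h
    · exact Or.inr (Or.inl h)
    · right; right
      rw [hx, h, hA]; ring
    · right; right
      rw [hx, h, hB]; ring
    · right; right
      have : xval c = 0 := by rw [hx]; omega
      rw [this]; ring
    · right; right
      have : xval c = -((n : ℤ) - 2 * w1) := by rw [hx]; omega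
      rw [this, hA]; ring
    · right; right
      have : xval c = -((n : ℤ) - 2 * w2) := by rw [hx]; omega
      rw [this, hB]; ring
  have van : ∀ c ∈ C,
      xval c ^ 2 * (xval c ^ 2 - A) * (xval c ^ 2 - B) * (xval c ^ 2 - n ^ 2) = 0 := by
    intro c hc
    rcases van0 c hc with h | h | h
    · rw [xval_eq, h]; push_cast; ring
    · rw [xval_eq, h]; ring
    · rw [h]; ring
  have q1 : (∑ c ∈ S, xval c ^ 8) - ((A + B) + (n : ℤ) ^ 2) * (∑ c ∈ S, xval c ^ 6)
      + (A * B + (A + B) * (n : ℤ) ^ 2) * (∑ c ∈ S, xval c ^ 4)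
      - A * B * (n : ℤ) ^ 2 * (∑ c ∈ S, xval c ^ 2) = 0 := by
    rw [Finset.mul_sum, Finset.mul_sum, Finset.mul_sum, ← Finset.sum_sub_distrib,
      ← Finset.sum_add_distrib, ← Finset.sum_sub_distrib]
    refine Finset.sum_eq_zero fun c hc => ?_
    linear_combination van c ((hmemS c).1 hc)
  have q2 : (∑ c ∈ S, xval c ^ 10) - ((A + B) + (n : ℤ) ^ 2) * (∑ c ∈ S, xval c ^ 8)
      + (A * B + (A + B) * (n : ℤ) ^ 2) * (∑ c ∈ S, xval c ^ 6)
      - A * B * (n : ℤ) ^ 2 * (∑ c ∈ S, xval c ^ 4) = 0 := by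
    rw [Finset.mul_sum, Finset.mul_sum, Finset.mul_sum, ← Finset.sum_sub_distrib,
      ← Finset.sum_add_distrib, ← Finset.sum_sub_distrib]
    refine Finset.sum_eq_zero fun c hc => ?_
    linear_combination xval c ^ 2 * van c ((hmemS c).1 hc)
  have x0 : xval (0 : Fin n → ZMod 2) = n := by simp [xval, chi_zero]
  have x1 : xval (fun _ => 1 : Fin n → ZMod 2) = -n := by simp [xval, chi_one]
  have hne01 : (0 : Fin n → ZMod 2) ≠ (fun _ => 1) := by
    intro h
    have := congrFun h ⟨0, by omega⟩
    simp at this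
  have q3 : (∑ c ∈ S, xval c ^ 6) - (A + B) * (∑ c ∈ S, xval c ^ 4)
      + A * B * (∑ c ∈ S, xval c ^ 2)
      = 2 * (n : ℤ) ^ 2 * ((n : ℤ) ^ 4 - (A + B) * (n : ℤ) ^ 2 + A * B) := by
    rw [Finset.mul_sum, Finset.mul_sum, ← Finset.sum_sub_distrib, ← Finset.sum_add_distrib]
    have hsub : ({0, fun _ => 1} : Finset (Fin n → ZMod 2)) ⊆ S := by
      intro c hc
      simp only [Finset.mem_insert, Finset.mem_singleton] at hc
      rw [hmemS]
      rcases hc with rfl | rfl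
      · exact C.zero_mem
      · exact h1
    rw [← Finset.sum_subset hsub, Finset.sum_pair hne01, x0, x1]
    · ring
    · intro c hc hnot
      simp only [Finset.mem_insert, Finset.mem_singleton, not_or] at hnot
      rcases van0 c ((hmemS c).1 hc) with h | h | h
      · exact absurd (wt_eq_zero c h) hnot.1
      · exfalso
        apply hnot.2
        have hz := wt_compl c
        rw [h, sub_self] at hz
        have := wt_eq_zero _ (by exact_mod_cast hz)
        funext i
        have := congrFun this i
        simp only [Pi.add_apply, Pi.zero_apply] at this
        generalize c i = a at this
        revert a; decide
      · linear_combination h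
  have fin := algebra_core n S.card (A + B) (A * B) _ _ _ _ _ (by exact_mod_cast hn) hpos
    g2 g4 g6 g8 g10 q1 q2 q3
  have hnZ : (20 : ℤ) ≤ n := by exact_mod_cast hn
  have hfpos : (0 : ℤ) ≤ (n : ℤ) ^ 4 - 10 * n ^ 3 + 55 * n ^ 2 - 110 * n + 184 := by
    by_contra hcon
    push Not at hcon
    nlinarith
  obtain ⟨f, hf⟩ := Int.eq_ofNat_of_zero_le hfpos
  refine numth n (Module.finrank (ZMod 2) C + 2) hn f ?_ ?_
  · zify
    rw [← hf]; ring
  · rw [hf, hcard] at fin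
    have : n * f = 60 * 2 ^ Module.finrank (ZMod 2) C := by exact_mod_cast fin
    rw [this, pow_add]; ring

theorem am_condition_five (n : ℕ) (C : Submodule (ZMod 2) (Fin n → ZMod 2))
    (hC0 : C ≠ ⊥) (hCtop : C ≠ ⊤)
    (h1 : (fun _ => (1 : ZMod 2)) ∈ C)
    (t : ℕ) (ht1 : 1 ≤ t) (ht2 : t < minDist (C : Set (Fin n → ZMod 2)))
    (hAM : {u | 0 < u ∧ u ≤ n - t ∧ ∃ c ∈ C, wt c = u}.ncard = minDist (dualSet C) - t)
    (hfive : minDist (dualSet C) - t = 5) :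
    (minDist (dualSet C) = 6 ∧ t = 1) ∨ (minDist (dualSet C) = 8 ∧ t = 3) ∨
      (minDist (dualSet C) = 10 ∧ t = 5) := by
  classical
  -- the dual distance is even
  have heven : 2 ∣ minDist (dualSet C) := by
    have hne : {u | ∃ x ∈ dualSet C, x ≠ 0 ∧ wt x = u}.Nonempty := by
      by_contra hcon
      rw [Set.not_nonempty_iff_eq_empty] at hcon
      have : minDist (dualSet C) = 0 := by rw [minDist, hcon, Nat.sInf_empty]
      omega
    obtain ⟨y, hy, -, hwy⟩ := Nat.sInf_mem hne
    change wt y = minDist (dualSet C) at hwy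
    rw [← hwy, ← ZMod.natCast_eq_zero_iff, wt_cast]
    have := hy _ h1
    simpa using this
  by_cases hsmall : t ≤ 6
  · omega
  exfalso
  have hdC : ∀ c ∈ C, c ≠ 0 → t < wt c := fun c hc hc0 =>
    lt_of_lt_of_le ht2 (Nat.sInf_le ⟨c, hc, hc0, rfl⟩)
  have hdd : ∀ y ∈ dualSet C, y ≠ 0 → 10 < wt y := by
    intro y hy hy0
    have : minDist (dualSet C) ≤ wt y := Nat.sInf_le ⟨y, hy, hy0, rfl⟩
    omega
  have hwz : wt (0 : Fin n → ZMod 2) = 0 := by simp [wt]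
  have hcompl : ∀ c ∈ C, (fun _ => 1) + c ∈ C := fun c hc => C.add_mem h1 hc
  rw [hfive] at hAM
  set U := {u | 0 < u ∧ u ≤ n - t ∧ ∃ c ∈ C, wt c = u} with hU
  have hfin : U.Finite := (Set.finite_Iic (n - t)).subset (fun u hu => hu.2.1)
  have hmem : ∀ u, u ∈ hfin.toFinset ↔ 0 < u ∧ u ≤ n - t ∧ ∃ c ∈ C, wt c = u := by
    intro u; rw [Set.Finite.mem_toFinset, hU]; rfl
  have hclass : ∀ c ∈ C, wt c = 0 ∨ wt c = n ∨ wt c ∈ hfin.toFinset := by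
    intro c hc
    have hz := wt_compl c
    by_cases h0 : wt c = 0
    · exact Or.inl h0
    by_cases hn : wt c = n
    · exact Or.inr (Or.inl hn)
    right; right
    rw [hmem]
    have hne : (fun _ => 1) + c ≠ 0 := by
      intro h
      rw [h, hwz] at hz
      omega
    have := hdC _ (hcompl c hc) hne
    exact ⟨by omega, by omega, c, hc, rfl⟩
  have hUC : ∀ u ∈ hfin.toFinset, t < u ∧ u < n ∧ n - u ∈ hfin.toFinset := by
    intro u hu
    obtain ⟨hu0, hut, c, hc, rfl⟩ := (hmem u).1 hu
    have hc0 : c ≠ 0 := by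
      rintro rfl
      omega
    have hlt := hdC c hc hc0
    have hz := wt_compl c
    refine ⟨hlt, by omega, ?_⟩
    rcases hclass _ (hcompl c hc) with h | h | h
    · omega
    · omega
    · have : wt ((fun _ => 1) + c) = n - wt c := by omega
      rwa [this] at h
  rw [Set.ncard_eq_toFinset_card _ hfin] at hAM
  obtain ⟨hn20, w1, w2, hw⟩ := weights_shape n hfin.toFinset hAM
    (fun u hu => by have := (hUC u hu).1; omega) (fun u hu => (hUC u hu).2.1)
    (fun u hu => (hUC u hu).2.2)
  refine core C hn20 h1 w1 w2 (fun c hc => ?_) hdd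
  rcases hclass c hc with h | h | h
  · exact Or.inl h
  · exact Or.inr (Or.inl h)
  · exact Or.inr (Or.inr (hw _ h))
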